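/- For every natural number d ≥ 3 there is a constant c > 0 with the following property. For every r > 0, every L > 0, and every L-Lipschitz map γ : S¹ → ℝ^d (where S¹ is the unit circle in ℂ) satisfying r ≤ ‖γ(z)‖ for all z ∈ S¹, there exists a (c·L)-Lipschitz map f : D² → ℝ^d (where D² is the closed unit disk in ℂ) such that f agrees with γ on S¹ = ∂D² and r ≤ ‖f(x)‖ for all x ∈ D². -/

import Mathlib

section PushOut

lemma abs_inv_norm_sub_mul_norm_le {E : Type*} [SeminormedAddCommGroup E] {x y : E}
    (hx : 0 < ‖x‖) (hy : 0 < ‖y‖) :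
    |‖x‖⁻¹ - ‖y‖⁻¹| * ‖y‖ ≤ ‖x‖⁻¹ * ‖x - y‖ := by
  have h : ‖x‖⁻¹ - ‖y‖⁻¹ = ‖x‖⁻¹ * (‖y‖ - ‖x‖) * ‖y‖⁻¹ := by field_simp
  rw [h, abs_mul, abs_mul, abs_of_pos (inv_pos.2 hx), abs_of_pos (inv_pos.2 hy),
    inv_mul_cancel_right₀ hy.ne', abs_sub_comm]
  gcongr
  exact abs_norm_sub_norm_le x y

variable {E : Type*} [NormedAddCommGroup E] [NormedSpace ℝ E]

lemma norm_inv_norm_smul_sub_le {x y : E} (hx : 1 ≤ ‖x‖) (hy : 1 ≤ ‖y‖) :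
    ‖‖x‖⁻¹ • x - ‖y‖⁻¹ • y‖ ≤ 2 * ‖x - y‖ := by
  have hx0 : 0 < ‖x‖ := by linarith
  have hy0 : 0 < ‖y‖ := by linarith
  have hinv : ‖x‖⁻¹ ≤ 1 := inv_le_one_of_one_le₀ hx
  have hdecomp : ‖x‖⁻¹ • x - ‖y‖⁻¹ • y = ‖x‖⁻¹ • (x - y) + (‖x‖⁻¹ - ‖y‖⁻¹) • y := by
    module
  calc ‖‖x‖⁻¹ • x - ‖y‖⁻¹ • y‖ ≤ ‖x‖⁻¹ * ‖x - y‖ + |‖x‖⁻¹ - ‖y‖⁻¹| * ‖y‖ := by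
        rw [hdecomp]
        refine (norm_add_le _ _).trans_eq ?_
        rw [norm_smul, norm_smul, Real.norm_eq_abs, Real.norm_eq_abs,
          abs_of_pos (inv_pos.2 hx0)]
    _ ≤ ‖x‖⁻¹ * ‖x - y‖ + ‖x‖⁻¹ * ‖x - y‖ :=
        add_le_add le_rfl (abs_inv_norm_sub_mul_norm_le hx0 hy0)
    _ ≤ 1 * ‖x - y‖ + 1 * ‖x - y‖ := by gcongr
    _ = 2 * ‖x - y‖ := by ring

/-- Push points of the unit ball radially out to the unit sphere. -/
noncomputable def pushOut (x : E) : E := max 1 ‖x‖⁻¹ • x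

lemma pushOut_of_one_le {x : E} (hx : 1 ≤ ‖x‖) : pushOut x = x := by
  rw [pushOut, max_eq_left (inv_le_one_of_one_le₀ hx), one_smul]

lemma one_le_norm_pushOut {x : E} (hx : 0 < ‖x‖) : 1 ≤ ‖pushOut x‖ := by
  rw [pushOut, norm_smul, Real.norm_eq_abs, abs_of_pos (by positivity)]
  calc 1 = ‖x‖⁻¹ * ‖x‖ := by field_simp
    _ ≤ max 1 ‖x‖⁻¹ * ‖x‖ := by
      gcongr
      exact le_max_right _ _

lemma norm_pushOut_sub_le {ε : ℝ} (hε : 0 < ε) (hε1 : ε ≤ 1) {x y : E}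
    (hx : ε ≤ ‖x‖) (hy : ε ≤ ‖y‖) :
    ‖pushOut x - pushOut y‖ ≤ 2 / ε * ‖x - y‖ := by
  have hx0 : 0 < ‖x‖ := by linarith
  have hy0 : 0 < ‖y‖ := by linarith
  have hinv : ‖x‖⁻¹ ≤ ε⁻¹ := inv_anti₀ hε hx
  have hmax : max 1 ‖x‖⁻¹ ≤ ε⁻¹ := max_le ((one_le_inv₀ hε).2 hε1) hinv
  have hdecomp : pushOut x - pushOut y =
      max 1 ‖x‖⁻¹ • (x - y) + (max 1 ‖x‖⁻¹ - max 1 ‖y‖⁻¹) • y := by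
    simp only [pushOut]
    module
  have hmaxdiff : |max 1 ‖x‖⁻¹ - max 1 ‖y‖⁻¹| ≤ |‖x‖⁻¹ - ‖y‖⁻¹| := by
    simpa using abs_max_sub_max_le_max 1 ‖x‖⁻¹ 1 ‖y‖⁻¹
  calc ‖pushOut x - pushOut y‖
      ≤ max 1 ‖x‖⁻¹ * ‖x - y‖ + |max 1 ‖x‖⁻¹ - max 1 ‖y‖⁻¹| * ‖y‖ := by
        rw [hdecomp]
        refine (norm_add_le _ _).trans_eq ?_
        rw [norm_smul, norm_smul, Real.norm_eq_abs, Real.norm_eq_abs,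
          abs_of_pos (by positivity : 0 < max 1 ‖x‖⁻¹)]
    _ ≤ max 1 ‖x‖⁻¹ * ‖x - y‖ + |‖x‖⁻¹ - ‖y‖⁻¹| * ‖y‖ := by gcongr
    _ ≤ max 1 ‖x‖⁻¹ * ‖x - y‖ + ‖x‖⁻¹ * ‖x - y‖ :=
        add_le_add le_rfl (abs_inv_norm_sub_mul_norm_le hx0 hy0)
    _ ≤ ε⁻¹ * ‖x - y‖ + ε⁻¹ * ‖x - y‖ := by gcongr
    _ = 2 / ε * ‖x - y‖ := by ring

end PushOut

section PolarMap

variable {E : Type*} [NormedAddCommGroup E] [NormedSpace ℝ E]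

/-- A homotopy of loops which contracts at least linearly at time `0` induces a Lipschitz map of
the unit disk; if it stays `ε` away from the origin, it can be pushed out of the unit ball. -/
lemma exists_lipschitz_filling {γ : Metric.sphere (0 : ℂ) 1 → E}
    {H : ℝ → Metric.sphere (0 : ℂ) 1 → E} {A B ε : ℝ} (hA : 0 ≤ A) (hB : 0 ≤ B)
    (hε : 0 < ε) (hε1 : ε ≤ 1)
    (hspace : ∀ t ∈ Set.Icc (0 : ℝ) 1, ∀ z w, ‖H t z - H t w‖ ≤ A * t * ‖(z : ℂ) - w‖)
    (htime : ∀ s ∈ Set.Icc (0 : ℝ) 1, ∀ t ∈ Set.Icc (0 : ℝ) 1, ∀ z,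
      ‖H s z - H t z‖ ≤ B * |s - t|)
    (hnorm : ∀ t ∈ Set.Icc (0 : ℝ) 1, ∀ z, ε ≤ ‖H t z‖)
    (hone : ∀ z, H 1 z = γ z) (hγ : ∀ z, 1 ≤ ‖γ z‖) :
    ∃ f : Metric.closedBall (0 : ℂ) 1 → E,
      LipschitzWith (Real.toNNReal (2 / ε * (2 * A + B))) f ∧
      (∀ z : Metric.sphere (0 : ℂ) 1, f ⟨z.1, Metric.sphere_subset_closedBall z.2⟩ = γ z) ∧
      ∀ x, 1 ≤ ‖f x‖ := by
  have hdir : ∀ x : ℂ, ∃ z : Metric.sphere (0 : ℂ) 1, (‖x‖ : ℂ) * z = x := by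
    intro x
    rcases eq_or_ne x 0 with rfl | hx
    · exact ⟨⟨1, by simp⟩, by simp⟩
    · have : (‖x‖ : ℂ) ≠ 0 := by simpa using hx
      exact ⟨⟨x / ‖x‖, by simp [hx]⟩, by simp only; field_simp⟩
  choose dir hdir using hdir
  have hmem : ∀ x : Metric.closedBall (0 : ℂ) 1, ‖(x : ℂ)‖ ∈ Set.Icc (0 : ℝ) 1 := fun x =>
    ⟨norm_nonneg _, mem_closedBall_zero_iff.1 x.2⟩
  have hnz : ∀ z : Metric.sphere (0 : ℂ) 1, ‖(z : ℂ)‖ = 1 := fun z => by simp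
  have hle : ∀ x y : Metric.closedBall (0 : ℂ) 1, ‖(x : ℂ)‖ ≤ ‖(y : ℂ)‖ →
      ‖H ‖(x : ℂ)‖ (dir x) - H ‖(y : ℂ)‖ (dir y)‖ ≤ (2 * A + B) * ‖(x : ℂ) - y‖ := by
    intro x y hxy
    have hrev : ‖(y : ℂ)‖ - ‖(x : ℂ)‖ ≤ ‖(x : ℂ) - y‖ := by
      rw [norm_sub_rev]
      exact norm_sub_norm_le _ _
    have hang : ‖(x : ℂ)‖ * ‖(dir x : ℂ) - dir y‖ ≤ 2 * ‖(x : ℂ) - y‖ := by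
      have h1 : ((‖(x : ℂ)‖ : ℝ) : ℂ) * ((dir x : ℂ) - dir y) =
          ((x : ℂ) - y) + ((‖(y : ℂ)‖ - ‖(x : ℂ)‖ : ℝ) : ℂ) * dir y := by
        push_cast
        linear_combination hdir x - hdir y
      have h2 : ‖((‖(x : ℂ)‖ : ℝ) : ℂ) * ((dir x : ℂ) - dir y)‖ =
          ‖(x : ℂ)‖ * ‖(dir x : ℂ) - dir y‖ := by simp
      rw [← h2, h1]
      refine (norm_add_le _ _).trans ?_
      rw [norm_mul, hnz, Complex.norm_real, Real.norm_eq_abs, abs_of_nonneg (by linarith)]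
      linarith
    calc ‖H ‖(x : ℂ)‖ (dir x) - H ‖(y : ℂ)‖ (dir y)‖
        ≤ ‖H ‖(x : ℂ)‖ (dir x) - H ‖(x : ℂ)‖ (dir y)‖ +
          ‖H ‖(x : ℂ)‖ (dir y) - H ‖(y : ℂ)‖ (dir y)‖ := norm_sub_le_norm_sub_add_norm_sub _ _ _
      _ ≤ A * ‖(x : ℂ)‖ * ‖(dir x : ℂ) - dir y‖ + B * |‖(x : ℂ)‖ - ‖(y : ℂ)‖| :=
          add_le_add (hspace _ (hmem x) _ _) (htime _ (hmem x) _ (hmem y) _)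
      _ ≤ A * (2 * ‖(x : ℂ) - y‖) + B * ‖(x : ℂ) - y‖ := by
          rw [mul_assoc]
          gcongr
          exact abs_norm_sub_norm_le _ _
      _ = (2 * A + B) * ‖(x : ℂ) - y‖ := by ring
  refine ⟨fun x => pushOut (H ‖(x : ℂ)‖ (dir x)), LipschitzWith.of_dist_le' fun x y => ?_,
    fun z => ?_, fun x => one_le_norm_pushOut (hε.trans_le (hnorm _ (hmem x) _))⟩
  · rw [dist_eq_norm, Subtype.dist_eq, dist_eq_norm]
    refine (norm_pushOut_sub_le hε hε1 (hnorm _ (hmem x) _) (hnorm _ (hmem y) _)).trans ?_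
    rw [mul_assoc]
    gcongr
    rcases le_total ‖(x : ℂ)‖ ‖(y : ℂ)‖ with h | h
    · exact hle x y h
    · rw [norm_sub_rev, norm_sub_rev (x : ℂ)]
      exact hle y x h
  · have hz : dir z = z := by
      have := hdir z
      rw [hnz] at this
      exact Subtype.ext (by simpa using this)
    simp only [hnz, hz, hone]
    exact pushOut_of_one_le (hγ z)

end PolarMap

section Polygon

variable {E : Type*} [NormedAddCommGroup E] [NormedSpace ℝ E]

/-- The polygonal path with vertex `q i` at each integer time `i`. -/
noncomputable def polygon (q : ℤ → E) (x : ℝ) : E :=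
  q ⌊x⌋ + Int.fract x • (q (⌊x⌋ + 1) - q ⌊x⌋)

lemma norm_add_smul_sub_le {a b p : E} {u R : ℝ} (hu : u ∈ Set.Icc (0 : ℝ) 1)
    (ha : ‖a - p‖ ≤ R) (hb : ‖b - p‖ ≤ R) : ‖a + u • (b - a) - p‖ ≤ R := by
  have : a + u • (b - a) - p = (1 - u) • (a - p) + u • (b - p) := by module
  rw [this]
  refine (norm_add_le _ _).trans ?_
  rw [norm_smul, norm_smul, Real.norm_of_nonneg hu.1, Real.norm_of_nonneg (sub_nonneg.2 hu.2)]
  nlinarith [hu.1, hu.2]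

lemma fract_mem_Icc (x : ℝ) : Int.fract x ∈ Set.Icc (0 : ℝ) 1 :=
  ⟨Int.fract_nonneg x, (Int.fract_lt_one x).le⟩

lemma norm_polygon_le {q : ℤ → E} (hq : ∀ i, ‖q i‖ ≤ 1) (x : ℝ) : ‖polygon q x‖ ≤ 1 := by
  simpa [polygon] using norm_add_smul_sub_le (p := (0 : E)) (fract_mem_Icc x)
    (by simpa using hq ⌊x⌋) (by simpa using hq (⌊x⌋ + 1))

lemma norm_polygon_sub_le {q : ℤ → E} (hq : ∀ i, ‖q i‖ ≤ 1) (x y : ℝ) :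
    ‖polygon q x - polygon q y‖ ≤ 2 * |x - y| := by
  wlog hxy : y ≤ x generalizing x y
  · rw [norm_sub_rev, abs_sub_comm]
    exact this y x (le_of_not_ge hxy)
  rw [abs_of_nonneg (sub_nonneg.2 hxy)]
  have hedge : ∀ i, ‖q (i + 1) - q i‖ ≤ 2 := fun i =>
    (norm_sub_le _ _).trans (by linarith [hq i, hq (i + 1)])
  have hfx := Int.floor_add_fract x
  have hfy := Int.floor_add_fract y
  have hmono : ⌊y⌋ ≤ ⌊x⌋ := Int.floor_mono hxy
  rcases hmono.eq_or_lt with h | h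
  · have hsub : polygon q x - polygon q y = (x - y) • (q (⌊y⌋ + 1) - q ⌊y⌋) := by
      have : x - y = Int.fract x - Int.fract y := by
        rw [h] at hfy
        linarith
      rw [this, polygon, polygon, ← h]
      module
    rw [hsub, norm_smul, Real.norm_of_nonneg (sub_nonneg.2 hxy), mul_comm]
    have := sub_nonneg.2 hxy
    gcongr
    exact hedge _
  · rcases (Int.add_one_le_of_lt h).eq_or_lt with h | h
    · have hsub : polygon q x - polygon q y = (1 - Int.fract y) • (q (⌊y⌋ + 1) - q ⌊y⌋) +
          Int.fract x • (q (⌊x⌋ + 1) - q ⌊x⌋) := by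
        rw [polygon, polygon, ← h]
        module
      have hcast : (⌊x⌋ : ℝ) = ⌊y⌋ + 1 := by
        rw [← h]
        push_cast
        rfl
      rw [hsub]
      refine (norm_add_le _ _).trans ?_
      rw [norm_smul, norm_smul, Real.norm_of_nonneg (Int.fract_nonneg x),
        Real.norm_of_nonneg (by linarith [Int.fract_lt_one y])]
      nlinarith [hedge ⌊y⌋, hedge ⌊x⌋, Int.fract_nonneg x, Int.fract_lt_one y]
    · have hcast : (⌊y⌋ : ℝ) + 2 ≤ ⌊x⌋ := by exact_mod_cast (by omega : ⌊y⌋ + 2 ≤ ⌊x⌋)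
      refine (norm_sub_le _ _).trans ?_
      linarith [norm_polygon_le hq x, norm_polygon_le hq y, Int.fract_nonneg x,
        Int.fract_lt_one y]

lemma polygon_add_int {q : ℤ → E} {n : ℤ} (hq : ∀ i, q (i + n) = q i) (x : ℝ) :
    polygon q (x + n) = polygon q x := by
  rw [polygon, polygon, Int.floor_add_intCast, Int.fract_add_intCast, hq,
    add_right_comm, hq]

/-- The closed polygonal loop with `N` edges and vertices `q 0, …, q (N - 1)`. -/
noncomputable def polygonLoop (N : ℕ) (q : ℤ → E) (z : ℂ) : E :=
  polygon q (N * (z.arg / (2 * Real.pi)))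

lemma exp_arg_mul_I {z : ℂ} (hz : ‖z‖ = 1) : Complex.exp (z.arg * Complex.I) = z := by
  simpa [hz] using Complex.norm_mul_exp_arg_mul_I z

lemma exists_angle_eq {z w : ℂ} (hz : ‖z‖ = 1) (hw : ‖w‖ = 1) :
    ∃ k : ℤ, InnerProductGeometry.angle z w = |z.arg - w.arg - k * (2 * Real.pi)| := by
  refine ⟨toIocDiv Real.two_pi_pos (-Real.pi) (z.arg - w.arg), ?_⟩
  have h := Complex.angle_exp_exp z.arg w.arg
  rw [exp_arg_mul_I hz, exp_arg_mul_I hw] at h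
  rw [h, toIocMod, zsmul_eq_mul]

lemma norm_polygonLoop_sub_le {N : ℕ} {q : ℤ → E} (hper : ∀ i, q (i + N) = q i)
    (hq : ∀ i, ‖q i‖ ≤ 1) {z w : ℂ} (hz : ‖z‖ = 1) (hw : ‖w‖ = 1) :
    ‖polygonLoop N q z - polygonLoop N q w‖ ≤ N * ‖z - w‖ := by
  obtain ⟨k, hk⟩ := exists_angle_eq hz hw
  have hper' : ∀ i, q (i + k * N) = q i := fun i => by
    have : Function.Periodic q (N : ℤ) := hper
    simpa using this.int_mul k i
  have hpi := Real.pi_pos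
  have hw' : polygonLoop N q w =
      polygon q (N * (w.arg / (2 * Real.pi)) + ((k * N : ℤ) : ℝ)) :=
    (polygon_add_int hper' _).symm
  have hang := Complex.angle_le_mul_norm_sub hz hw
  rw [hw', polygonLoop]
  refine (norm_polygon_sub_le hq _ _).trans ?_
  have harg : N * (z.arg / (2 * Real.pi)) - (N * (w.arg / (2 * Real.pi)) + ((k * N : ℤ) : ℝ)) =
      N / (2 * Real.pi) * (z.arg - w.arg - k * (2 * Real.pi)) := by
    push_cast
    field_simp
    ring
  rw [harg, abs_mul, ← hk, abs_of_nonneg (by positivity)]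
  calc 2 * (N / (2 * Real.pi) * InnerProductGeometry.angle z w)
      ≤ 2 * (N / (2 * Real.pi) * (Real.pi / 2 * ‖z - w‖)) := by gcongr
    _ = N / 2 * ‖z - w‖ := by field_simp
    _ ≤ N * ‖z - w‖ := by
      gcongr
      linarith [(Nat.cast_nonneg N : (0 : ℝ) ≤ N)]

lemma norm_exp_mul_I_sub_le (a b : ℝ) :
    ‖Complex.exp (a * Complex.I) - Complex.exp (b * Complex.I)‖ ≤ |a - b| := by
  have h : Complex.exp (a * Complex.I) - Complex.exp (b * Complex.I) =
      Complex.exp (b * Complex.I) * (Complex.exp (Complex.I * (a - b : ℝ)) - 1) := by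
    rw [mul_sub, ← Complex.exp_add, mul_one]
    congr 2
    push_cast
    ring
  rw [h, norm_mul, Complex.norm_exp_ofReal_mul_I, one_mul]
  exact Real.norm_exp_I_mul_ofReal_sub_one_le

/-- A Lipschitz loop in the unit sphere is approximated by a closed polygonal loop whose vertices
belong to a prescribed net of the sphere. -/
lemma exists_polygonal_approx {Q : Set E} (hunit : ∀ a ∈ Q, ‖a‖ = 1)
    (hnet : ∀ x : E, ‖x‖ = 1 → ∃ a ∈ Q, ‖a - x‖ ≤ 1 / 8)
    {θ : Metric.sphere (0 : ℂ) 1 → E} (hθ : ∀ z, ‖θ z‖ = 1) {K : ℝ} (hK : 0 ≤ K)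
    (hlip : ∀ z w, ‖θ z - θ w‖ ≤ K * ‖(z : ℂ) - w‖) {N : ℕ} (hN : 0 < N)
    (hKN : K * (2 * Real.pi / N) ≤ 1 / 4) :
    ∃ P : Metric.sphere (0 : ℂ) 1 → E,
      (∀ z w, ‖P z - P w‖ ≤ N * ‖(z : ℂ) - w‖) ∧ (∀ z, ‖P z‖ ≤ 1) ∧
      (∀ z, ‖P z - θ z‖ ≤ 3 / 8) ∧
      ∀ z, ∃ a ∈ Q, ∃ b ∈ Q, ‖b - a‖ ≤ 3 / 4 ∧
        ∃ u ∈ Set.Icc (0 : ℝ) 1, P z = a + u • (b - a) := by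
  have hpi := Real.pi_pos
  have hN' : (0 : ℝ) < N := by exact_mod_cast hN
  choose snap hsnapQ hsnap using hnet
  let V : ℤ → Metric.sphere (0 : ℂ) 1 := fun i =>
    ⟨Complex.exp ((2 * Real.pi / N * i : ℝ) * Complex.I), by
      rw [mem_sphere_zero_iff_norm, Complex.norm_exp_ofReal_mul_I]⟩
  have hV : ∀ i, V (i + N) = V i := by
    intro i
    refine Subtype.ext ?_
    simp only [V]
    rw [Complex.exp_eq_exp_iff_exists_int]
    refine ⟨1, ?_⟩
    have : (N : ℂ) ≠ 0 := by exact_mod_cast hN.ne'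
    push_cast
    field_simp
  let q : ℤ → E := fun i => snap (θ (V i)) (hθ _)
  have hqQ : ∀ i, q i ∈ Q := fun i => hsnapQ _ _
  have hq1 : ∀ i, ‖q i‖ ≤ 1 := fun i => (hunit _ (hqQ i)).le
  have hqper : ∀ i, q (i + N) = q i := fun i => by simp only [q, hV]
  have hnorm : ∀ z : Metric.sphere (0 : ℂ) 1, ‖(z : ℂ)‖ = 1 := fun z => by simp
  have hclose : ∀ (z : Metric.sphere (0 : ℂ) 1) (i : ℤ),
      |N * ((z : ℂ).arg / (2 * Real.pi)) - i| ≤ 1 → ‖q i - θ z‖ ≤ 3 / 8 := by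
    intro z i hi
    have hzV : ‖(V i : ℂ) - z‖ ≤ 2 * Real.pi / N := by
      rw [norm_sub_rev, ← exp_arg_mul_I (hnorm z)]
      refine (norm_exp_mul_I_sub_le _ _).trans ?_
      have : (z : ℂ).arg - 2 * Real.pi / N * i =
          2 * Real.pi / N * (N * ((z : ℂ).arg / (2 * Real.pi)) - i) := by field_simp
      rw [this, abs_mul, abs_of_pos (by positivity)]
      exact mul_le_of_le_one_right (by positivity) hi
    calc ‖q i - θ z‖ ≤ ‖q i - θ (V i)‖ + ‖θ (V i) - θ z‖ :=
          norm_sub_le_norm_sub_add_norm_sub _ _ _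
      _ ≤ 1 / 8 + K * (2 * Real.pi / N) := by
          refine add_le_add (hsnap _ _) ((hlip _ _).trans ?_)
          gcongr
      _ ≤ 3 / 8 := by linarith
  have hfloor : ∀ z : Metric.sphere (0 : ℂ) 1,
      ‖q ⌊N * ((z : ℂ).arg / (2 * Real.pi))⌋ - θ z‖ ≤ 3 / 8 ∧
      ‖q (⌊N * ((z : ℂ).arg / (2 * Real.pi))⌋ + 1) - θ z‖ ≤ 3 / 8 := by
    intro z
    have h1 := Int.floor_le (N * ((z : ℂ).arg / (2 * Real.pi)))
    have h2 := Int.lt_floor_add_one (N * ((z : ℂ).arg / (2 * Real.pi)))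
    constructor <;> refine hclose z _ (abs_le.2 ?_) <;> push_cast <;> constructor <;> linarith
  refine ⟨fun z => polygonLoop N q z,
    fun z w => norm_polygonLoop_sub_le hqper hq1 (hnorm z) (hnorm w),
    fun z => norm_polygon_le hq1 _,
    fun z => norm_add_smul_sub_le (fract_mem_Icc _) (hfloor z).1 (hfloor z).2,
    fun z => ⟨_, hqQ _, _, hqQ _, ?_, _, fract_mem_Icc _, rfl⟩⟩
  refine (norm_sub_le_norm_sub_add_norm_sub _ (θ z) _).trans ?_
  rw [norm_sub_rev (θ z)]
  linarith [(hfloor z).1, (hfloor z).2]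

end Polygon

section ConePoint

variable {E : Type*} [NormedAddCommGroup E] [NormedSpace ℝ E]

lemma exists_notMem_span_pair {Q : Set E} (hQ : Q.Finite) (hE : 3 ≤ Module.finrank ℝ E) :
    ∃ v : E, ∀ a ∈ Q, ∀ b ∈ Q, v ∉ Submodule.span ℝ {a, b} := by
  by_contra! h
  have := hQ.to_subtype
  obtain ⟨⟨a, b⟩, hab⟩ := Subspace.exists_eq_top_of_iUnion_eq_univ (k := ℝ)
    (p := fun i : Q × Q => Submodule.span ℝ {(i.1 : E), (i.2 : E)}) (by
      refine Set.eq_univ_of_forall fun v => ?_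
      obtain ⟨a, ha, b, hb, hv⟩ := h v
      exact Set.mem_iUnion.2 ⟨(⟨a, ha⟩, ⟨b, hb⟩), hv⟩)
  classical
  have hcard : Module.finrank ℝ (Submodule.span ℝ {(a : E), (b : E)}) ≤ 2 := by
    have h1 := finrank_span_finset_le_card (R := ℝ) ({(a : E), (b : E)} : Finset E)
    rw [Finset.coe_pair] at h1
    exact h1.trans Finset.card_le_two
  simp only at hab
  rw [hab, finrank_top] at hcard
  omega

/-- In dimension at least three, the short segments between finitely many unit vectors can be
coned off uniformly away from the origin. -/
lemma exists_cone_point {Q : Set E} (hQ : Q.Finite) (hunit : ∀ a ∈ Q, ‖a‖ = 1)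
    (hE : 3 ≤ Module.finrank ℝ E) :
    ∃ v : E, ∃ ε : ℝ, 0 < ε ∧ ∀ a ∈ Q, ∀ b ∈ Q, ‖b - a‖ ≤ 3 / 4 →
      ∀ s ∈ Set.Icc (0 : ℝ) 1, ∀ u ∈ Set.Icc (0 : ℝ) 1,
        ε ≤ ‖s • (a + u • (b - a)) + (1 - s) • v‖ := by
  obtain ⟨v, hv⟩ := exists_notMem_span_pair hQ hE
  let S : Set (E × E) := {p ∈ Q ×ˢ Q | ‖p.2 - p.1‖ ≤ 3 / 4}
  have hS : IsCompact S := ((hQ.prod hQ).subset (Set.sep_subset _ _)).isCompact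
  obtain ⟨ε, hε, hmin⟩ :=
    (hS.prod ((isCompact_Icc (a := (0 : ℝ)) (b := 1)).prod
      (isCompact_Icc (a := (0 : ℝ)) (b := 1)))).exists_forall_le' (a := 0)
      (f := fun p : (E × E) × ℝ × ℝ =>
        ‖p.2.1 • (p.1.1 + p.2.2 • (p.1.2 - p.1.1)) + (1 - p.2.1) • v‖)
      (by fun_prop) (by
        rintro ⟨⟨a, b⟩, s, u⟩ ⟨⟨⟨ha, hb⟩, hab⟩, hs, hu⟩
        simp only at ha hb hab hs hu ⊢
        rw [norm_pos_iff]
        intro h0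
        rcases eq_or_ne s 1 with rfl | hs1
        · have h1 : a = -(u • (b - a)) := by
            simp only [one_smul, sub_self, zero_smul, add_zero] at h0
            exact eq_neg_of_add_eq_zero_left h0
          have h2 := hunit a ha
          rw [h1, norm_neg, norm_smul, Real.norm_of_nonneg hu.1] at h2
          nlinarith [hu.1, hu.2, norm_nonneg (b - a)]
        · have hs0 : 1 - s ≠ 0 := sub_ne_zero.2 hs1.symm
          refine hv a ha b hb ?_
          have hmem : (1 - s) • v ∈ Submodule.span ℝ {a, b} := by
            rw [eq_neg_of_add_eq_zero_right h0]
            have ha' : a ∈ Submodule.span ℝ {a, b} := Submodule.subset_span (by simp)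
            have hb' : b ∈ Submodule.span ℝ {a, b} := Submodule.subset_span (by simp)
            exact Submodule.neg_mem _ (Submodule.smul_mem _ _ (Submodule.add_mem _ ha'
              (Submodule.smul_mem _ _ (Submodule.sub_mem _ hb' ha'))))
          exact (Submodule.smul_mem_iff _ hs0).1 hmem)
  exact ⟨v, ε, hε, fun a ha b hb hab s hs u hu => hmin ((a, b), s, u) ⟨⟨⟨ha, hb⟩, hab⟩, hs, hu⟩⟩

end ConePoint

section Filling

variable {E : Type*} [NormedAddCommGroup E] [NormedSpace ℝ E]

/-- A loop with a point that is far from the origin relative to its Lipschitz constant can be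
coned off to that point. -/
lemma exists_filling_of_far_point {L : ℝ} (hL : 0 < L) {γ : Metric.sphere (0 : ℂ) 1 → E}
    (hlip : ∀ z w, ‖γ z - γ w‖ ≤ L * ‖(z : ℂ) - w‖) (hγ : ∀ z, 1 ≤ ‖γ z‖)
    {z₀ : Metric.sphere (0 : ℂ) 1} (hz₀ : 4 * L ≤ ‖γ z₀‖) :
    ∃ f : Metric.closedBall (0 : ℂ) 1 → E,
      LipschitzWith (Real.toNNReal (16 * L)) f ∧
      (∀ z : Metric.sphere (0 : ℂ) 1, f ⟨z.1, Metric.sphere_subset_closedBall z.2⟩ = γ z) ∧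
      ∀ x, 1 ≤ ‖f x‖ := by
  have hdiam : ∀ z, ‖γ z - γ z₀‖ ≤ 2 * L := fun z => by
    have h : ‖(z : ℂ) - z₀‖ ≤ 2 := (norm_sub_le _ _).trans (by simp; norm_num)
    nlinarith [hlip z z₀]
  have key := exists_lipschitz_filling (γ := γ) (H := fun t z => γ z₀ + t • (γ z - γ z₀))
    (A := L) (B := 2 * L) (ε := 1 / 2) hL.le (by linarith) (by norm_num) (by norm_num)
    (fun t ht z w => by
      have : γ z₀ + t • (γ z - γ z₀) - (γ z₀ + t • (γ w - γ z₀)) = t • (γ z - γ w) := by module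
      rw [this, norm_smul, Real.norm_of_nonneg ht.1]
      nlinarith [hlip z w, ht.1])
    (fun s _ t _ z => by
      have : γ z₀ + s • (γ z - γ z₀) - (γ z₀ + t • (γ z - γ z₀)) = (s - t) • (γ z - γ z₀) := by
        module
      rw [this, norm_smul, Real.norm_eq_abs, mul_comm]
      gcongr
      exact hdiam z)
    (fun t ht z => by
      have h1 : ‖t • (γ z - γ z₀)‖ ≤ 2 * L := by
        rw [norm_smul, Real.norm_of_nonneg ht.1]
        nlinarith [hdiam z, ht.1, ht.2, norm_nonneg (γ z - γ z₀)]
      have h2 := norm_sub_le_norm_add (γ z₀) (t • (γ z - γ z₀))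
      linarith [hγ z₀])
    (fun z => by simp) hγ
  rwa [show 2 / (1 / 2) * (2 * L + 2 * L) = 16 * L by ring] at key

/-- A loop `γ` avoiding the unit ball is homotoped straight to a polygonal loop `P` close to its
radial projection, which is then coned off to `v`. -/
lemma exists_filling_of_approx {L ε C : ℝ} (hL : 1 ≤ 4 * L) (hC : 0 ≤ C) (hε : 0 < ε)
    (hε2 : ε ≤ 1 / 2) {v : E} {γ P : Metric.sphere (0 : ℂ) 1 → E}
    (hlip : ∀ z w, ‖γ z - γ w‖ ≤ L * ‖(z : ℂ) - w‖) (hγ : ∀ z, 1 ≤ ‖γ z‖)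
    (hbound : ∀ z, ‖γ z‖ ≤ 4 * L)
    (hP : ∀ z w, ‖P z - P w‖ ≤ C * L * ‖(z : ℂ) - w‖) (hP1 : ∀ z, ‖P z‖ ≤ 1)
    (happrox : ∀ z, ‖P z - ‖γ z‖⁻¹ • γ z‖ ≤ 1 / 2)
    (hcone : ∀ z, ∀ s ∈ Set.Icc (0 : ℝ) 1, ε ≤ ‖s • P z + (1 - s) • v‖) :
    ∃ f : Metric.closedBall (0 : ℂ) 1 → E,
      LipschitzWith (Real.toNNReal (2 / ε * (4 * C + 20 + 8 * ‖v‖) * L)) f ∧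
      (∀ z : Metric.sphere (0 : ℂ) 1, f ⟨z.1, Metric.sphere_subset_closedBall z.2⟩ = γ z) ∧
      ∀ x, 1 ≤ ‖f x‖ := by
  have hL0 : 0 < L := by linarith
  let α : ℝ → ℝ := fun t => max (2 * t - 1) 0
  let β : ℝ → ℝ := fun t => min (2 * t) (2 - 2 * t)
  let δ : ℝ → ℝ := fun t => max (1 - 2 * t) 0
  have hα : ∀ s t, |α s - α t| ≤ 2 * |s - t| := fun s t => by
    refine (abs_max_sub_max_le_max _ _ _ _).trans ?_
    rw [sub_self, abs_zero, max_eq_left (abs_nonneg _),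
      show 2 * s - 1 - (2 * t - 1) = 2 * (s - t) by ring, abs_mul, abs_two]
  have hδ : ∀ s t, |δ s - δ t| ≤ 2 * |s - t| := fun s t => by
    refine (abs_max_sub_max_le_max _ _ _ _).trans ?_
    rw [sub_self, abs_zero, max_eq_left (abs_nonneg _), abs_sub_comm s t,
      show 1 - 2 * s - (1 - 2 * t) = 2 * (t - s) by ring, abs_mul, abs_two]
  have hβ : ∀ s t, |β s - β t| ≤ 2 * |s - t| := fun s t => by
    refine (abs_min_sub_min_le_max _ _ _ _).trans (max_le ?_ ?_)
    · rw [← mul_sub, abs_mul, abs_two]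
    · rw [abs_sub_comm s t, show 2 - 2 * s - (2 - 2 * t) = 2 * (t - s) by ring, abs_mul, abs_two]
  have key := exists_lipschitz_filling (γ := γ)
    (H := fun t z => α t • γ z + β t • P z + δ t • v)
    (A := (1 + 2 * C) * L) (B := (16 + 8 * ‖v‖) * L + 2 * L) (ε := ε) (by positivity)
    (by positivity) hε (by linarith)
    (fun t ht z w => by
      have hαt : α t ≤ t := max_le (by linarith [ht.2]) ht.1
      have hα0 : 0 ≤ α t := le_max_right _ _
      have hβt : β t ≤ 2 * t := min_le_left _ _
      have hβ0 : 0 ≤ β t := le_min (by linarith [ht.1]) (by linarith [ht.2])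
      have : α t • γ z + β t • P z + δ t • v - (α t • γ w + β t • P w + δ t • v) =
          α t • (γ z - γ w) + β t • (P z - P w) := by module
      rw [this]
      refine (norm_add_le _ _).trans ?_
      rw [norm_smul, norm_smul, Real.norm_of_nonneg hα0, Real.norm_of_nonneg hβ0]
      calc α t * ‖γ z - γ w‖ + β t * ‖P z - P w‖
          ≤ t * (L * ‖(z : ℂ) - w‖) + 2 * t * (C * L * ‖(z : ℂ) - w‖) := by
            have := ht.1
            gcongr
            · exact hlip z w
            · exact hP z w
        _ = (1 + 2 * C) * L * t * ‖(z : ℂ) - w‖ := by ring)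
    (fun s _ t _ z => by
      have : α s • γ z + β s • P z + δ s • v - (α t • γ z + β t • P z + δ t • v) =
          (α s - α t) • γ z + (β s - β t) • P z + (δ s - δ t) • v := by module
      rw [this]
      refine norm_add₃_le.trans ?_
      rw [norm_smul, norm_smul, norm_smul, Real.norm_eq_abs, Real.norm_eq_abs, Real.norm_eq_abs]
      calc |α s - α t| * ‖γ z‖ + |β s - β t| * ‖P z‖ + |δ s - δ t| * ‖v‖
          ≤ 2 * |s - t| * (4 * L) + 2 * |s - t| * (4 * L) + 2 * |s - t| * (4 * L * ‖v‖) := by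
            gcongr
            · exact hα s t
            · exact hbound z
            · exact hβ s t
            · exact (hP1 z).trans hL
            · exact hδ s t
            · exact le_mul_of_one_le_left (norm_nonneg _) hL
        _ = (16 + 8 * ‖v‖) * L * |s - t| := by ring
        _ ≤ ((16 + 8 * ‖v‖) * L + 2 * L) * |s - t| := by
            gcongr
            linarith)
    (fun t ht z => by
      rcases le_total (2 * t) 1 with h | h
      · have h1 : α t = 0 := max_eq_right (by linarith)
        have h2 : β t = 2 * t := min_eq_left (by linarith)
        have h3 : δ t = 1 - 2 * t := max_eq_left (by linarith)
        simp only [h1, h2, h3, zero_smul, zero_add]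
        exact hcone z _ ⟨by linarith [ht.1], h⟩
      · have h1 : α t = 2 * t - 1 := max_eq_left (by linarith)
        have h2 : β t = 2 - 2 * t := min_eq_right (by linarith)
        have h3 : δ t = 0 := max_eq_right (by linarith)
        simp only [h1, h2, h3, zero_smul, add_zero]
        have hn0 : 0 < ‖γ z‖ := by linarith [hγ z]
        have hsplit : (2 * t - 1) • γ z + (2 - 2 * t) • P z =
            ((2 * t - 1) * ‖γ z‖ + (2 - 2 * t)) • (‖γ z‖⁻¹ • γ z) +
              (2 - 2 * t) • (P z - ‖γ z‖⁻¹ • γ z) := by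
          have hself : γ z = ‖γ z‖ • (‖γ z‖⁻¹ • γ z) := by
            rw [smul_smul, mul_inv_cancel₀ hn0.ne', one_smul]
          nth_rw 1 [hself]
          module
        have hmain : ‖((2 * t - 1) * ‖γ z‖ + (2 - 2 * t)) • (‖γ z‖⁻¹ • γ z)‖ =
            (2 * t - 1) * ‖γ z‖ + (2 - 2 * t) := by
          rw [norm_smul, norm_smul, norm_inv, norm_norm, inv_mul_cancel₀ hn0.ne', mul_one,
            Real.norm_of_nonneg (by nlinarith [ht.2])]
        have herr : ‖(2 - 2 * t) • (P z - ‖γ z‖⁻¹ • γ z)‖ ≤ (2 - 2 * t) * (1 / 2) := by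
          rw [norm_smul, Real.norm_of_nonneg (by linarith [ht.2])]
          have : 0 ≤ 2 - 2 * t := by linarith [ht.2]
          gcongr
          exact happrox z
        rw [hsplit]
        have := norm_sub_le_norm_add (((2 * t - 1) * ‖γ z‖ + (2 - 2 * t)) • (‖γ z‖⁻¹ • γ z))
          ((2 - 2 * t) • (P z - ‖γ z‖⁻¹ • γ z))
        nlinarith [hγ z])
    (fun z => by
      have h1 : α 1 = 1 := by norm_num [α]
      have h2 : β 1 = 0 := by norm_num [β]
      have h3 : δ 1 = 0 := by norm_num [δ]
      simp [h1, h2, h3]) hγ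
  rwa [show 2 / ε * (2 * ((1 + 2 * C) * L) + ((16 + 8 * ‖v‖) * L + 2 * L)) =
    2 / ε * (4 * C + 20 + 8 * ‖v‖) * L by ring] at key

/-- The avoidant filling statement for the unit ball of a space of dimension at least three. -/
lemma exists_avoidant_filling_unit [FiniteDimensional ℝ E] (hE : 3 ≤ Module.finrank ℝ E) :
    ∃ c : ℝ, 0 < c ∧ ∀ L : ℝ, 0 < L → ∀ γ : Metric.sphere (0 : ℂ) 1 → E,
      (∀ z w, ‖γ z - γ w‖ ≤ L * ‖(z : ℂ) - w‖) → (∀ z, 1 ≤ ‖γ z‖) →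
      ∃ f : Metric.closedBall (0 : ℂ) 1 → E,
        LipschitzWith (Real.toNNReal (c * L)) f ∧
        (∀ z : Metric.sphere (0 : ℂ) 1, f ⟨z.1, Metric.sphere_subset_closedBall z.2⟩ = γ z) ∧
        ∀ x, 1 ≤ ‖f x‖ := by
  have := FiniteDimensional.proper ℝ E
  obtain ⟨Q, hQsub, hQ, hcover⟩ :=
    (isCompact_sphere (0 : E) 1).finite_cover_balls (e := 1 / 8) (by norm_num)
  have hunit : ∀ a ∈ Q, ‖a‖ = 1 := fun a ha => mem_sphere_zero_iff_norm.1 (hQsub ha)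
  have hnet : ∀ x : E, ‖x‖ = 1 → ∃ a ∈ Q, ‖a - x‖ ≤ 1 / 8 := fun x hx => by
    obtain ⟨a, ha, hxa⟩ := Set.mem_iUnion₂.1 (hcover (mem_sphere_zero_iff_norm.2 hx))
    exact ⟨a, ha, by rw [norm_sub_rev]; exact (mem_ball_iff_norm.1 hxa).le⟩
  obtain ⟨v, ε₀, hε₀, hcone⟩ := exists_cone_point hQ hunit hE
  set ε := min ε₀ (1 / 2)
  have hε : 0 < ε := lt_min hε₀ (by norm_num)
  have hε2 : ε ≤ 1 / 2 := min_le_right _ _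
  set C : ℝ := 16 * Real.pi + 4
  have hpi := Real.pi_pos
  have hC : 0 ≤ C := by positivity
  set c : ℝ := 2 / ε * (4 * C + 20 + 8 * ‖v‖)
  have hc : 0 < c := by positivity
  refine ⟨max 16 c, by positivity, fun L hL γ hlip hγ => ?_⟩
  suffices h : ∃ c' ≤ max 16 c, ∃ f : Metric.closedBall (0 : ℂ) 1 → E,
      LipschitzWith (Real.toNNReal (c' * L)) f ∧
      (∀ z : Metric.sphere (0 : ℂ) 1, f ⟨z.1, Metric.sphere_subset_closedBall z.2⟩ = γ z) ∧
      ∀ x, 1 ≤ ‖f x‖ by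
    obtain ⟨c', hc', f, hf, hrest⟩ := h
    exact ⟨f, hf.weaken (Real.toNNReal_le_toNNReal (by gcongr)), hrest⟩
  by_cases hfar : ∃ z₀, 4 * L ≤ ‖γ z₀‖
  · obtain ⟨z₀, hz₀⟩ := hfar
    exact ⟨16, le_max_left _ _, exists_filling_of_far_point hL hlip hγ hz₀⟩
  push Not at hfar
  have hL4 : 1 ≤ 4 * L := (hγ ⟨1, by simp⟩).trans (hfar _).le
  set N := ⌈16 * Real.pi * L⌉₊
  have hNpos : 0 < N := Nat.ceil_pos.2 (by positivity)
  have hN' : (0 : ℝ) < N := by exact_mod_cast hNpos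
  have hNle : 16 * Real.pi * L ≤ N := Nat.le_ceil _
  have hNC : (N : ℝ) ≤ C * L := by
    have := (Nat.ceil_lt_add_one (by positivity : 0 ≤ 16 * Real.pi * L)).le
    calc (N : ℝ) ≤ 16 * Real.pi * L + 1 := this
      _ ≤ 16 * Real.pi * L + 4 * L := by gcongr
      _ = C * L := by ring
  obtain ⟨P, hP, hP1, happrox, hmem⟩ := exists_polygonal_approx hunit hnet
    (θ := fun z => ‖γ z‖⁻¹ • γ z) (fun z => by
      have : ‖γ z‖ ≠ 0 := by linarith [hγ z]
      rw [norm_smul, norm_inv, norm_norm, inv_mul_cancel₀ this])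
    (K := 2 * L) (by positivity) (fun z w => by
      refine (norm_inv_norm_smul_sub_le (hγ z) (hγ w)).trans ?_
      rw [mul_assoc]
      gcongr
      exact hlip z w) hNpos (by
      rw [← mul_div_assoc, div_le_iff₀ hN']
      linarith)
  refine ⟨c, le_max_right _ _, exists_filling_of_approx (P := P) hL4 hC hε hε2 hlip hγ
    (fun z => (hfar z).le) (fun z w => (hP z w).trans (by gcongr)) hP1
    (fun z => (happrox z).trans (by norm_num)) (fun z s hs => ?_)⟩
  obtain ⟨a, ha, b, hb, hab, u, hu, hPz⟩ := hmem z
  rw [hPz]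
  exact (min_le_left _ _).trans (hcone a ha b hb hab s hs u hu)

end Filling

/-- Quantitative avoidant filling in Euclidean space: for `d ≥ 3` there is `c > 0`
such that every `L`-Lipschitz loop `γ : S¹ → ℝ^d` avoiding the open ball of radius `r`
about the origin extends to a `(c·L)`-Lipschitz map of the unit disk which still
avoids that ball. -/
theorem stmt_2 (d : ℕ) (hd : 3 ≤ d) :
    ∃ c : ℝ, 0 < c ∧
      ∀ (r : ℝ), 0 < r → ∀ (L : ℝ), 0 < L →
        ∀ γ : Metric.sphere (0 : ℂ) 1 → EuclideanSpace ℝ (Fin d),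
          LipschitzWith (Real.toNNReal L) γ →
          (∀ z, r ≤ ‖γ z‖) →
          ∃ f : Metric.closedBall (0 : ℂ) 1 → EuclideanSpace ℝ (Fin d),
            LipschitzWith (Real.toNNReal (c * L)) f ∧
            (∀ z : Metric.sphere (0 : ℂ) 1,
              f ⟨z.1, Metric.sphere_subset_closedBall z.2⟩ = γ z) ∧
            (∀ x, r ≤ ‖f x‖) := by
  obtain ⟨c, hc, hfill⟩ := exists_avoidant_filling_unit (E := EuclideanSpace ℝ (Fin d))
    (by simpa using hd)
  refine ⟨c, hc, fun r hr L hL γ hγ hnorm => ?_⟩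
  obtain ⟨f, hf, hbdry, hf1⟩ := hfill (L / r) (by positivity) (fun z => r⁻¹ • γ z)
    (fun z w => by
      have h := hγ.dist_le_mul z w
      rw [dist_eq_norm, Subtype.dist_eq, dist_eq_norm, Real.coe_toNNReal _ hL.le] at h
      rw [← smul_sub, norm_smul, Real.norm_of_nonneg (by positivity), div_eq_inv_mul, mul_assoc]
      gcongr)
    (fun z => by
      rw [norm_smul, Real.norm_of_nonneg (by positivity), ← inv_mul_cancel₀ hr.ne']
      gcongr
      exact hnorm z)
  refine ⟨fun x => r • f x, LipschitzWith.of_dist_le' fun x y => ?_, fun z => ?_, fun x => ?_⟩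
  · have h := hf.dist_le_mul x y
    rw [Real.coe_toNNReal _ (by positivity)] at h
    rw [dist_smul₀, Real.norm_of_nonneg hr.le]
    calc r * dist (f x) (f y) ≤ r * (c * (L / r) * dist x y) := by gcongr
      _ = c * L * dist x y := by field_simp
  · simp only [hbdry, smul_smul, mul_inv_cancel₀ hr.ne', one_smul]
  · rw [norm_smul, Real.norm_of_nonneg hr.le]
    exact le_mul_of_one_le_right hr.le (hf1 x)
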